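/- arXiv:2108.05676 — 8 statements merged into one kernel-verified Lean document; each statement's English description precedes it below -/
import Mathlib

section
/- Let n ≥ 2 be an even integer and d ≥ 1 an integer, and define ψ(x) = Σ_{i=0}^{n−1} (1 + (−1)^i x^{i+1}) d^{n−1−i} for real x. Then ψ(x) ≤ 0 for every real number x ≥ d + 1. -/
open Finset

/-- Two consecutive terms of Soares' generating function have nonpositive sum. -/
lemma soares_pair_nonpos {d x : ℝ} (hd : 0 ≤ d) (hx : d + 1 ≤ x) (m : ℕ) :
    (1 + x ^ (m + 1)) * d + (1 - x ^ (m + 2)) ≤ 0 := by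
  have hpow : x ≤ x ^ (m + 1) := le_self_pow₀ (by linarith) m.succ_ne_zero
  have hmul : x ^ (m + 1) * 1 ≤ x ^ (m + 1) * (x - d) :=
    mul_le_mul_of_nonneg_left (by linarith) (by linarith)
  linear_combination hmul + hpow + hx

/-- Soares' generating function for `n = 2 * k`, with a real parameter `d`. -/
lemma soares_sum_two_mul_nonpos {d x : ℝ} (hd : 0 ≤ d) (hx : d + 1 ≤ x) (k : ℕ) :
    ∑ i ∈ range (2 * k), (1 + (-1 : ℝ) ^ i * x ^ (i + 1)) * d ^ (2 * k - 1 - i) ≤ 0 := by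
  induction k with
  | zero => simp
  | succ k ih =>
    have hshift : ∑ i ∈ range (2 * k),
          (1 + (-1 : ℝ) ^ i * x ^ (i + 1)) * d ^ (2 * (k + 1) - 1 - i) =
        (∑ i ∈ range (2 * k), (1 + (-1 : ℝ) ^ i * x ^ (i + 1)) * d ^ (2 * k - 1 - i)) *
          d ^ 2 := by
      rw [sum_mul]
      refine sum_congr rfl fun i hi => ?_
      have hi' := mem_range.mp hi
      rw [show 2 * (k + 1) - 1 - i = (2 * k - 1 - i) + 2 by omega, pow_add d, mul_assoc]
    rw [show range (2 * (k + 1)) = range (2 * k + 1 + 1) from rfl, sum_range_succ,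
      sum_range_succ, hshift, show 2 * (k + 1) - 1 - 2 * k = 1 by omega,
      show 2 * (k + 1) - 1 - (2 * k + 1) = 0 by omega, pow_succ (-1 : ℝ) (2 * k),
      (even_two_mul k).neg_one_pow]
    linear_combination mul_nonpos_of_nonpos_of_nonneg ih (sq_nonneg d) +
      soares_pair_nonpos hd hx (2 * k)

/-- Soares' generating function is nonpositive on `x ≥ d + 1` for `n` even. -/
theorem soares_psi_nonpos (n d : ℕ) (hn : 2 ≤ n) (hne : Even n) (hd : 1 ≤ d)
    (x : ℝ) (hx : (d : ℝ) + 1 ≤ x) :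
    ∑ i ∈ Finset.range n, (1 + (-1 : ℝ) ^ i * x ^ (i + 1)) * (d : ℝ) ^ (n - 1 - i) ≤ 0 := by
  obtain ⟨k, rfl⟩ := hne.exists_two_nsmul
  exact soares_sum_two_mul_nonpos d.cast_nonneg hx k
end

section
/- Let n ≥ 2 be an even integer, d ≥ 1 an integer, and m ≥ 1 an integer. If Σ_{i=0}^{n−1} (1 + (−1)^i (m−1)^{i+1}) d^{n−1−i} > 0, then m ≤ d + 1. -/
open Finset

/-- Horner-type recursion for sums `∑ a i * d ^ (n - 1 - i)`. -/
lemma sum_mul_pow_sub_succ {R : Type*} [CommSemiring R] (a : ℕ → R) (d : R) (n : ℕ) :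
    ∑ i ∈ range (n + 1), a i * d ^ (n + 1 - 1 - i) =
      d * ∑ i ∈ range n, a i * d ^ (n - 1 - i) + a n := by
  rw [sum_range_succ, mul_sum]
  congr 1
  · refine sum_congr rfl fun i hi => ?_
    have hi' := mem_range.1 hi
    rw [show n + 1 - 1 - i = n - 1 - i + 1 by omega, pow_succ]
    ring
  · simp

/-- Soares' generating function with an even number of terms is nonpositive for `x ≥ d + 1`. -/
lemma soares_sum_nonpos {d x : ℤ} (hd : 0 ≤ d) (hx : d + 1 ≤ x) (k : ℕ) :
    ∑ i ∈ range (2 * k), (1 + (-1 : ℤ) ^ i * x ^ (i + 1)) * d ^ (2 * k - 1 - i) ≤ 0 := by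
  induction k with
  | zero => simp
  | succ k ih =>
    rw [show 2 * (k + 1) = 2 * k + 1 + 1 by ring,
      sum_mul_pow_sub_succ (fun i => 1 + (-1 : ℤ) ^ i * x ^ (i + 1)),
      sum_mul_pow_sub_succ (fun i => 1 + (-1 : ℤ) ^ i * x ^ (i + 1))]
    have hpow : x ≤ x ^ (2 * k + 1) := le_self_pow₀ (by linarith) (by omega)
    have hpair : x ^ (2 * k + 1) ≤ x ^ (2 * k + 1) * (x - d) :=
      le_mul_of_one_le_right (by linarith) (by linarith)
    have hprev := mul_nonpos_of_nonneg_of_nonpos (mul_nonneg hd hd) ih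
    have hone : (-1 : ℤ) ^ (2 * k) = 1 := by simp
    simp only [pow_succ _ (2 * k + 1), pow_succ (-1 : ℤ) (2 * k), hone]
    linarith

/-- Soares' bound `m ≤ d + 1` from positivity of the generating function, `n` even. -/
theorem soares_bound_of_pos (n : ℕ) (hn : 2 ≤ n) (hne : Even n) (d m : ℤ)
    (hd : 1 ≤ d) (hm : 1 ≤ m)
    (h : 0 < ∑ i ∈ Finset.range n, (1 + (-1 : ℤ) ^ i * (m - 1) ^ (i + 1)) * d ^ (n - 1 - i)) :
    m ≤ d + 1 := by
  obtain ⟨k, rfl⟩ := hne.exists_two_nsmul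
  by_contra! hlt
  exact absurd h (soares_sum_nonpos (by linarith) (by linarith) k).not_gt
end

section
/- Let R be a commutative ring and let a₀, …, aₙ be a regular sequence in R. If b₀, …, bₙ ∈ R satisfy Σ_{i=0}^{n} bᵢ aᵢ = 0, then there exist elements P_{ij} ∈ R for 0 ≤ i, j ≤ n with P_{ij} = −P_{ji} (in particular P_{ii} = 0) such that b_k = Σ_{i=0}^{n} P_{ik} aᵢ for every k. -/
open RingTheory.Sequence in
/-- Appending `r` to a weakly regular sequence: if `x * r` lies in the ideal generated by the
sequence, then so does `x`. -/
theorem RingTheory.Sequence.IsWeaklyRegular.mem_ofList_of_mul_mem {R : Type*} [CommRing R]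
    {rs : List R} {r x : R} (h : IsWeaklyRegular R (rs ++ [r])) (hx : x * r ∈ Ideal.ofList rs) :
    x ∈ Ideal.ofList rs := by
  have hr := (isWeaklyRegular_singleton_iff _ _).mp ((isWeaklyRegular_append_iff R _ _).mp h).2
  have key := (isSMulRegular_quotient_iff_mem_of_smul_mem _ _).mp hr x
  simp only [smul_eq_mul, Ideal.mul_top] at key
  exact key (mul_comm x r ▸ hx)

theorem Ideal.ofList_ofFn {R : Type*} [CommRing R] {m : ℕ} (a : Fin m → R) :
    Ideal.ofList (List.ofFn a) = Ideal.span (Set.range a) := by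
  simp only [Ideal.ofList, List.mem_ofFn]
  rfl

/-- The relations of a weakly regular sequence are given by alternating matrices. -/
theorem RingTheory.Sequence.IsWeaklyRegular.exists_alternating_of_sum_eq_zero
    {R : Type*} [CommRing R] {m : ℕ} {a : Fin m → R} (h : IsWeaklyRegular R (List.ofFn a))
    {b : Fin m → R} (hb : ∑ i, b i * a i = 0) :
    ∃ P : Fin m → Fin m → R,
      (∀ i, P i i = 0) ∧ (∀ i j, P i j = -P j i) ∧ ∀ k, b k = ∑ i, P i k * a i := by
  induction m with
  | zero => exact ⟨0, by simp, by simp, fun k => k.elim0⟩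
  | succ m ih =>
    rw [List.ofFn_succ', List.concat_eq_append] at h
    rw [Fin.sum_univ_castSucc] at hb
    have hlast : b (Fin.last m) ∈ Ideal.span (Set.range fun i : Fin m => a i.castSucc) := by
      rw [← Ideal.ofList_ofFn]
      refine h.mem_ofList_of_mul_mem ?_
      rw [Ideal.ofList_ofFn, eq_neg_of_add_eq_zero_right hb]
      exact neg_mem (Ideal.sum_mem _ fun i _ =>
        Ideal.mul_mem_left _ _ (Ideal.subset_span ⟨i, rfl⟩))
    obtain ⟨c, hc⟩ := Ideal.mem_span_range_iff_exists_fun.mp hlast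
    obtain ⟨Q, hQ_diag, hQ_skew, hQ⟩ := ih ((isWeaklyRegular_append_iff R _ _).mp h).1
      (b := fun i => b i.castSucc + c i * a (Fin.last m)) (by
        rw [← hb, ← hc, Finset.sum_mul, ← Finset.sum_add_distrib]
        exact Finset.sum_congr rfl fun i _ => by ring)
    refine ⟨Fin.snoc (fun i => Fin.snoc (Q i) (c i)) (Fin.snoc (fun i => -c i) 0), ?_, ?_, ?_⟩
    · intro i
      cases i using Fin.lastCases <;> simp [hQ_diag]
    · intro i j
      cases i using Fin.lastCases <;> cases j using Fin.lastCases <;> simp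
      exact hQ_skew _ _
    · intro k
      rw [Fin.sum_univ_castSucc]
      cases k using Fin.lastCases with
      | last => simp [hc]
      | cast k => simp [← hQ k]

/-- First syzygies of a regular sequence are generated by the Koszul relations. -/
theorem koszul_first_syzygy {R : Type*} [CommRing R] (n : ℕ) (a : Fin (n + 1) → R)
    (hreg : RingTheory.Sequence.IsRegular R (List.ofFn a))
    (b : Fin (n + 1) → R) (hb : ∑ i, b i * a i = 0) :
    ∃ P : Fin (n + 1) → Fin (n + 1) → R,
      (∀ i j, P i j = -P j i) ∧ ∀ k, b k = ∑ i, P i k * a i := by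
  obtain ⟨P, -, hP⟩ := hreg.toIsWeaklyRegular.exists_alternating_of_sum_eq_zero hb
  exact ⟨P, hP⟩
end

section
/- Let n ≥ 1 and let f ∈ ℂ[z₀, …, zₙ] be a homogeneous polynomial of degree m ≥ 2 such that the only common zero in ℂ^{n+1} of the partial derivatives ∂f/∂z₀, …, ∂f/∂zₙ is the origin. Let d ≥ 0 and let g₀, …, gₙ ∈ ℂ[z₀, …, zₙ] be homogeneous of degree d such that f divides Σ_{i=0}^{n} gᵢ ∂f/∂zᵢ. Then there exist polynomials P_{ij} (0 ≤ i, j ≤ n) with P_{ij} = −P_{ji}, each P_{ij} either zero or homogeneous of degree d − m + 1, and a polynomial h, either zero or homogeneous of degree d − 1, such that m·g_k = m·Σ_{i=0}^{n} P_{ik} ∂f/∂zᵢ + h·z_k for every k. -/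
open MvPolynomial

/-! ### Regular elements modulo an ideal on free modules -/

theorem Module.Free.mem_smul_top_of_smul_mem {R N : Type*} [CommRing R] [AddCommGroup N]
    [Module R N] [Module.Free R N] {J : Ideal R} {x : R} (hx : ∀ r, x * r ∈ J → r ∈ J)
    {v : N} (hv : x • v ∈ J • (⊤ : Submodule R N)) : v ∈ J • (⊤ : Submodule R N) := by
  let B := Module.Free.chooseBasis R N
  rw [← B.linearCombination_repr v, Finsupp.linearCombination_apply]
  refine Submodule.sum_mem _ fun i _ => Submodule.smul_mem_smul (hx _ ?_) trivial
  have hmem : B.coord i (x • v) ∈ (J • (⊤ : Submodule R N)).map (B.coord i) :=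
    Submodule.mem_map_of_mem hv
  rw [Submodule.map_smul''] at hmem
  have hle : J • (⊤ : Submodule R N).map (B.coord i) ≤ J := Ideal.mul_le_left
  simpa using hle hmem

theorem Submodule.mem_smul_of_smul_mem_smul {R N : Type*} [CommRing R] [AddCommGroup N]
    [Module R N] {A : Submodule R N} [Module.Free R A] {J : Ideal R} {x : R}
    (hx : ∀ r, x * r ∈ J → r ∈ J) {v : N} (hvA : v ∈ A) (hv : x • v ∈ J • A) : v ∈ J • A := by
  lift v to A using hvA
  rw [← A.coe_smul, ← Submodule.mem_smul_top_iff] at hv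
  rw [← Submodule.mem_smul_top_iff]
  exact Module.Free.mem_smul_top_of_smul_mem hx hv

theorem Submodule.apply_mem_smul_of_mapsTo {R N N' : Type*} [CommRing R] [AddCommGroup N]
    [Module R N] [AddCommGroup N'] [Module R N'] {J : Ideal R} {A : Submodule R N}
    {B : Submodule R N'} (F : N →ₗ[R] N') (hF : ∀ y ∈ A, F y ∈ B) {c : N} (hc : c ∈ J • A) :
    F c ∈ J • B := by
  have hmem := Submodule.mem_map_of_mem (f := F) hc
  rw [Submodule.map_smul''] at hmem
  exact Submodule.smul_mono le_rfl (Submodule.map_le_iff_le_comap.2 hF) hmem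

/-! ### Exactness of the Koszul complex modulo an ideal -/

section Koszul

open CliffordAlgebra (contractLeft)

variable {R M : Type*} [CommRing R] [AddCommGroup M] [Module R M]

theorem ExteriorAlgebra.ι_mul_mem_exteriorPower (a : M) {i : ℕ} {c : ExteriorAlgebra R M}
    (hc : c ∈ ⋀[R]^i M) : ExteriorAlgebra.ι R a * c ∈ ⋀[R]^(i + 1) M := by
  rw [ExteriorAlgebra.exteriorPower, pow_succ']
  exact Submodule.mul_mem_mul ⟨a, rfl⟩ hc

/-- The differential of the Koszul complex of the linear form `φ`. -/
noncomputable def koszulDifferential (φ : Module.Dual R M) :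
    ExteriorAlgebra R M →ₗ[R] ExteriorAlgebra R M :=
  contractLeft (Q := (0 : QuadraticForm R M)) φ

theorem koszulDifferential_ι_mul (φ : Module.Dual R M) (a : M) (c : ExteriorAlgebra R M) :
    koszulDifferential φ (ExteriorAlgebra.ι R a * c) =
      φ a • c - ExteriorAlgebra.ι R a * koszulDifferential φ c :=
  CliffordAlgebra.contractLeft_ι_mul _ _ _

theorem koszulDifferential_ι (φ : Module.Dual R M) (a : M) :
    koszulDifferential φ (ExteriorAlgebra.ι R a) = algebraMap R _ (φ a) :=
  CliffordAlgebra.contractLeft_ι _ _ _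

theorem koszulDifferential_koszulDifferential (φ : Module.Dual R M) (c : ExteriorAlgebra R M) :
    koszulDifferential φ (koszulDifferential φ c) = 0 :=
  CliffordAlgebra.contractLeft_contractLeft _ _

theorem koszulDifferential_mem (φ : Module.Dual R M) (i : ℕ) :
    ∀ c ∈ ⋀[R]^(i + 1) M, koszulDifferential φ c ∈ ⋀[R]^i M := by
  induction i with
  | zero =>
    intro c hc
    rw [ExteriorAlgebra.exteriorPower, zero_add, pow_one] at hc
    obtain ⟨a, rfl⟩ := hc
    rw [koszulDifferential_ι, ExteriorAlgebra.exteriorPower, pow_zero]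
    exact Submodule.algebraMap_mem _
  | succ i ih =>
    intro c hc
    rw [ExteriorAlgebra.exteriorPower, pow_succ'] at hc
    refine Submodule.mul_induction_on hc ?_ ?_
    · rintro _ ⟨a, rfl⟩ c hc
      rw [koszulDifferential_ι_mul]
      exact Submodule.sub_mem _ (Submodule.smul_mem _ _ hc)
        (ExteriorAlgebra.ι_mul_mem_exteriorPower a (ih c hc))
    · intro b c hb hc
      rw [map_add]
      exact Submodule.add_mem _ hb hc

/-- The Koszul complex of `φ` with coefficients in `R ⧸ J` is exact in degree `i + 1`. -/
def KoszulExactMod (φ : Module.Dual R M) (J : Ideal R) (i : ℕ) : Prop :=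
  ∀ c ∈ ⋀[R]^(i + 1) M, koszulDifferential φ c ∈ J • ⋀[R]^i M →
    ∃ b ∈ ⋀[R]^(i + 2) M, c - koszulDifferential φ b ∈ J • ⋀[R]^(i + 1) M

/-- If `x` lies in the image of `φ` and is regular modulo `J`, then exactness modulo `J + (x)`
in one degree gives exactness modulo `J` in the degree below. -/
theorem KoszulExactMod.of_sup_span [Module.Free R M] {φ : Module.Dual R M} {J : Ideal R}
    {i : ℕ} {x : R} (hφ : ∃ a, φ a = x) (hx : ∀ r, x * r ∈ J → r ∈ J)
    (h : KoszulExactMod φ (J ⊔ Ideal.span {x}) (i + 1)) : KoszulExactMod φ J i := by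
  intro c hc hdc
  obtain ⟨a, rfl⟩ := hφ
  have hmul : ExteriorAlgebra.ι R a * koszulDifferential φ c ∈ J • ⋀[R]^(i + 1) M :=
    Submodule.apply_mem_smul_of_mapsTo (LinearMap.mulLeft R (ExteriorAlgebra.ι R a))
      (fun _ hy => ExteriorAlgebra.ι_mul_mem_exteriorPower a hy) hdc
  have hbd : koszulDifferential φ (ExteriorAlgebra.ι R a * c) ∈
      (J ⊔ Ideal.span {φ a}) • ⋀[R]^(i + 1) M := by
    rw [koszulDifferential_ι_mul]
    refine Submodule.sub_mem _ (Submodule.smul_mem_smul ?_ hc)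
      (Submodule.smul_mono_left le_sup_left hmul)
    exact Ideal.mem_sup_right (Ideal.mem_span_singleton_self _)
  obtain ⟨b, -, hb⟩ := h _ (ExteriorAlgebra.ι_mul_mem_exteriorPower a hc) hbd
  rw [Submodule.sup_smul, Submodule.mem_sup] at hb
  obtain ⟨j, hj, y, hy, hjy⟩ := hb
  rw [Submodule.ideal_span_singleton_smul] at hy
  obtain ⟨k, hk, rfl⟩ := hy
  refine ⟨k, hk, ?_⟩
  have hdj : koszulDifferential φ j ∈ J • ⋀[R]^(i + 1) M :=
    Submodule.apply_mem_smul_of_mapsTo _ (koszulDifferential_mem φ _) hj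
  have key : φ a • (c - koszulDifferential φ k) =
      ExteriorAlgebra.ι R a * koszulDifferential φ c + koszulDifferential φ j := by
    have := congrArg (koszulDifferential φ) hjy
    rw [map_sub, koszulDifferential_ι_mul, map_add,
      koszulDifferential_koszulDifferential, sub_zero] at this
    rw [smul_sub, sub_eq_iff_eq_add, add_assoc, ← sub_eq_iff_eq_add', ← this]
    simp
  have hmem : c - koszulDifferential φ k ∈ ⋀[R]^(i + 1) M :=
    Submodule.sub_mem _ hc (koszulDifferential_mem φ _ k hk)
  refine Submodule.mem_smul_of_smul_mem_smul hx hmem ?_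
  rw [key]
  exact Submodule.add_mem _ hmul hdj

theorem koszulExactMod_of_card_le {σ : Type*} [Fintype σ] (b : Module.Basis σ R M)
    (φ : Module.Dual R M) (J : Ideal R) {i : ℕ} (hi : Fintype.card σ ≤ i) :
    KoszulExactMod φ J i := by
  intro c hc _
  let B := (b.reindex (Fintype.equivFin σ)).exteriorPower (i + 1)
  have : IsEmpty (Set.powersetCard (Fin (Fintype.card σ)) (i + 1)) := by
    refine ⟨fun s => ?_⟩
    have h1 := Finset.card_le_univ s.1
    have h2 : s.1.card = i + 1 := s.2
    rw [Fintype.card_fin] at h1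
    omega
  have hsub : Subsingleton (⋀[R]^(i + 1) M) := B.repr.injective.subsingleton
  have hc0 : c = 0 := congrArg Subtype.val (Subsingleton.elim (⟨c, hc⟩ : ⋀[R]^(i + 1) M) 0)
  exact ⟨0, Submodule.zero_mem _, by simp [hc0]⟩

/-- Boundaries in degree one of the Koszul complex are given by alternating matrices. -/
theorem exists_alternating_of_mem_exteriorPower_two {σ : Type*} [Fintype σ]
    (f : σ → R) {b : ExteriorAlgebra R (σ → R)} (hb : b ∈ ⋀[R]^2 (σ → R)) :
    ∃ P : σ → σ → R, (∀ i j, P i j = -P j i) ∧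
      koszulDifferential (Fintype.linearCombination R f) b =
        ExteriorAlgebra.ι R (fun k => ∑ i, P i k * f i) := by
  rw [ExteriorAlgebra.exteriorPower, pow_two] at hb
  refine Submodule.mul_induction_on hb ?_ ?_
  · rintro _ ⟨u, rfl⟩ _ ⟨v, rfl⟩
    refine ⟨fun i j => u i * v j - u j * v i, fun i j => by ring, ?_⟩
    rw [koszulDifferential_ι_mul, koszulDifferential_ι, ← Algebra.commutes, ← Algebra.smul_def,
      ← map_smul, ← map_smul, ← map_sub]
    congr 1
    ext k
    simp only [Fintype.linearCombination_apply, smul_eq_mul, Pi.sub_apply, Pi.smul_apply,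
      sub_mul, Finset.sum_sub_distrib, Finset.sum_mul]
    congr 1 <;> exact Finset.sum_congr rfl fun i _ => by ring
  · rintro x y ⟨P, hP, hx⟩ ⟨Q, hQ, hy⟩
    refine ⟨fun i j => P i j + Q i j, fun i j => by linear_combination hP i j + hQ i j, ?_⟩
    rw [map_add, hx, hy, ← map_add]
    congr 1
    ext k
    simp [add_mul, Finset.sum_add_distrib]

end Koszul

/-! ### Syzygies of polynomials whose ideal contains powers of all variables -/

namespace MvPolynomial

theorem mem_span_X_pow_of_X_pow_mul_mem {σ R : Type*} [CommRing R] (N : σ → ℕ) {S : Set σ}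
    {i : σ} (hi : i ∉ S) {p : MvPolynomial σ R}
    (hp : X i ^ N i * p ∈ Ideal.span ((fun j => X j ^ N j) '' S)) :
    p ∈ Ideal.span ((fun j => (X j : MvPolynomial σ R) ^ N j) '' S) := by
  classical
  have himage : ((fun j => (X j : MvPolynomial σ R) ^ N j) '' S) =
      (fun s => monomial s (1 : R)) '' ((fun j => Finsupp.single j (N j)) '' S) := by
    rw [Set.image_image]
    simp only [X_pow_eq_monomial]
  rw [himage, mem_ideal_span_monomial_image] at hp ⊢
  intro s hs
  obtain ⟨_, ⟨j, hj, rfl⟩, hle⟩ := hp (Finsupp.single i (N i) + s) (by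
    rw [mem_support_iff, X_pow_eq_monomial, coeff_monomial_mul, one_mul]
    exact mem_support_iff.1 hs)
  refine ⟨_, ⟨j, hj, rfl⟩, ?_⟩
  have hij : i ≠ j := fun h => hi (h ▸ hj)
  rw [Finsupp.single_le_iff] at hle ⊢
  simpa [Finsupp.single_apply, hij] using hle

/-- If as many polynomials as there are variables generate an ideal containing a power of every
variable, then all their syzygies are Koszul syzygies. -/
theorem exists_alternating_of_sum_mul_eq_zero {σ R : Type*} [Fintype σ] [CommRing R]
    (f : σ → MvPolynomial σ R) (hX : ∀ i, X i ∈ (Ideal.span (Set.range f)).radical)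
    (g : σ → MvPolynomial σ R) (hg : ∑ i, g i * f i = 0) :
    ∃ P : σ → σ → MvPolynomial σ R, (∀ i j, P i j = -P j i) ∧
      ∀ k, g k = ∑ i, P i k * f i := by
  classical
  choose N hN using hX
  let φ : Module.Dual (MvPolynomial σ R) (σ → MvPolynomial σ R) :=
    Fintype.linearCombination (MvPolynomial σ R) f
  have hexact : ∀ S : Finset σ, KoszulExactMod φ
      (Ideal.span ((fun j => (X j : MvPolynomial σ R) ^ N j) '' (S : Set σ))) S.card := by
    intro S
    induction hk : Fintype.card σ - S.card generalizing S with
    | zero => exact koszulExactMod_of_card_le (Pi.basisFun _ σ) φ _ (by omega)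
    | succ k ih =>
      obtain ⟨i, hi⟩ : ∃ i, i ∉ S := by
        by_contra! hall
        rw [Finset.eq_univ_of_forall hall, Finset.card_univ] at hk
        omega
      have hcard := Finset.card_insert_of_notMem hi
      refine KoszulExactMod.of_sup_span (x := X i ^ N i) ?_
        (fun p hp => mem_span_X_pow_of_X_pow_mul_mem N (by simpa using hi) hp) ?_
      · obtain ⟨a, ha⟩ := (Ideal.mem_span_range_iff_exists_fun).1 (hN i)
        exact ⟨a, by simpa [φ, Fintype.linearCombination_apply] using ha⟩
      · have := ih (insert i S) (by omega)
        rwa [hcard, Finset.coe_insert, Set.image_insert_eq, Ideal.span_insert, sup_comm] at this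
  have h0 := hexact ∅
  rw [Finset.coe_empty, Set.image_empty, Ideal.span_empty, Finset.card_empty] at h0
  obtain ⟨b, hb, hgb⟩ := h0 (ExteriorAlgebra.ι _ g) (by
      rw [ExteriorAlgebra.exteriorPower, zero_add, pow_one]
      exact ⟨g, rfl⟩) (by
      have : φ g = 0 := by simpa [φ, Fintype.linearCombination_apply] using hg
      rw [koszulDifferential_ι, this, map_zero]
      exact Submodule.zero_mem _)
  obtain ⟨P, hP, hPb⟩ := exists_alternating_of_mem_exteriorPower_two f hb
  rw [Submodule.bot_smul, Submodule.mem_bot, sub_eq_zero, hPb] at hgb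
  exact ⟨P, hP, fun k => congrFun (ExteriorAlgebra.ι_leftInverse.injective hgb) k⟩

theorem X_mem_radical_span_of_forall_eval_eq_zero {σ ι k : Type*} [Finite σ] [Field k]
    [IsAlgClosed k] (f : ι → MvPolynomial σ k)
    (hzero : ∀ z : σ → k, (∀ i, eval z (f i) = 0) → z = 0) (i : σ) :
    X i ∈ (Ideal.span (Set.range f)).radical := by
  rw [← vanishingIdeal_zeroLocus_eq_radical (K := k), mem_vanishingIdeal_iff]
  intro z hz
  rw [zeroLocus_span] at hz
  have := hzero z fun j => by simpa [aeval_eq_eval] using hz (f j) ⟨j, rfl⟩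
  simp [this]

/-! ### Homogeneous components of products -/

/-- The homogeneous component of degree `d - e`, which is zero when `d < e`. -/
noncomputable def componentSub {σ R : Type*} [CommSemiring R] (d e : ℕ) :
    MvPolynomial σ R →ₗ[R] MvPolynomial σ R :=
  if e ≤ d then homogeneousComponent (d - e) else 0

theorem componentSub_eq_zero_or_isHomogeneous {σ R : Type*} [CommSemiring R] (d e : ℕ)
    (p : MvPolynomial σ R) :
    componentSub d e p = 0 ∨ e ≤ d ∧ (componentSub d e p).IsHomogeneous (d - e) := by
  unfold componentSub
  split_ifs with h
  · exact Or.inr ⟨h, homogeneousComponent_isHomogeneous _ _⟩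
  · exact Or.inl rfl

theorem homogeneousComponent_mul_of_isHomogeneous {σ R : Type*} [CommSemiring R] (d : ℕ) {e : ℕ}
    (p : MvPolynomial σ R) {q : MvPolynomial σ R} (hq : q.IsHomogeneous e) :
    homogeneousComponent d (p * q) = componentSub d e p * q := by
  induction p using MvPolynomial.induction_on' with
  | add p₁ p₂ h₁ h₂ => rw [add_mul, map_add, h₁, h₂, map_add, add_mul]
  | monomial s r =>
    have hs : (monomial s r).IsHomogeneous s.degree := isHomogeneous_monomial r rfl
    rw [homogeneousComponent_of_mem (hs.mul hq), componentSub]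
    split_ifs with h₁ h₂ h₂
    · rw [homogeneousComponent_of_mem hs, if_pos (by omega)]
    · omega
    · rw [homogeneousComponent_of_mem hs, if_neg (by omega), zero_mul]
    · simp

end MvPolynomial

/-- Esteves' normal form (after Zariski) for homogeneous vector fields tangent to a
smooth hypersurface `{f = 0} ⊂ ℙⁿ`. -/
theorem esteves_normal_form (n : ℕ) (hn : 1 ≤ n) (m : ℕ) (hm : 2 ≤ m)
    (f : MvPolynomial (Fin (n + 1)) ℂ) (hf : f.IsHomogeneous m)
    (hzero : ∀ z : Fin (n + 1) → ℂ, (∀ i, eval z (pderiv i f) = 0) → z = 0)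
    (d : ℕ) (g : Fin (n + 1) → MvPolynomial (Fin (n + 1)) ℂ)
    (hg : ∀ i, (g i).IsHomogeneous d)
    (hinv : f ∣ ∑ i, g i * pderiv i f) :
    ∃ P : Fin (n + 1) → Fin (n + 1) → MvPolynomial (Fin (n + 1)) ℂ,
      (∀ i j, P i j = -P j i) ∧
      (∀ i j, P i j = 0 ∨ ∃ e : ℕ, (e : ℤ) = (d : ℤ) - m + 1 ∧ (P i j).IsHomogeneous e) ∧
      ∃ h : MvPolynomial (Fin (n + 1)) ℂ,
        (h = 0 ∨ ∃ e : ℕ, (e : ℤ) = (d : ℤ) - 1 ∧ h.IsHomogeneous e) ∧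
        ∀ k, (m : MvPolynomial (Fin (n + 1)) ℂ) * g k =
          (m : MvPolynomial (Fin (n + 1)) ℂ) * (∑ i, P i k * pderiv i f) + h * X k := by
  obtain ⟨q, hq⟩ := hinv
  have hm0 : (m : ℂ) ≠ 0 := by exact_mod_cast (by omega : m ≠ 0)
  have hEuler : ∑ i, X i * pderiv i f = (m : MvPolynomial (Fin (n + 1)) ℂ) * f := by
    rw [hf.sum_X_mul_pderiv, nsmul_eq_mul]
  have hCm : (m : MvPolynomial (Fin (n + 1)) ℂ) * C (m : ℂ)⁻¹ = 1 := by
    rw [← map_natCast (C : ℂ →+* MvPolynomial (Fin (n + 1)) ℂ), ← C_mul, mul_inv_cancel₀ hm0, C_1]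
  obtain ⟨P, hP, hPg⟩ := exists_alternating_of_sum_mul_eq_zero (fun i => pderiv i f)
    (X_mem_radical_span_of_forall_eval_eq_zero _ hzero)
    (fun k => g k - C (m : ℂ)⁻¹ * q * X k) (by
      simp only [sub_mul, Finset.sum_sub_distrib, mul_assoc, ← Finset.mul_sum, hEuler, hq]
      linear_combination (-(q * f)) * hCm)
  have hrel : ∀ k, g k = ∑ i, componentSub d (m - 1) (P i k) * pderiv i f +
      componentSub d 1 (C (m : ℂ)⁻¹ * q) * X k := by
    intro k
    have := congrArg (homogeneousComponent d) (sub_eq_iff_eq_add.1 (hPg k))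
    rwa [homogeneousComponent_eq_self (hg k), map_add, map_sum,
      homogeneousComponent_mul_of_isHomogeneous d _ (isHomogeneous_X _ k),
      Finset.sum_congr rfl fun i _ =>
        homogeneousComponent_mul_of_isHomogeneous d (P i k) hf.pderiv] at this
  refine ⟨fun i j => componentSub d (m - 1) (P i j), fun i j => by simp only [hP i j, map_neg],
    fun i j => ?_, (m : MvPolynomial (Fin (n + 1)) ℂ) * componentSub d 1 (C (m : ℂ)⁻¹ * q), ?_, fun k => ?_⟩
  · refine (componentSub_eq_zero_or_isHomogeneous d (m - 1) (P i j)).imp_right ?_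
    rintro ⟨hle, hhom⟩
    exact ⟨d - (m - 1), by omega, hhom⟩
  · obtain h0 | ⟨hle, hhom⟩ := componentSub_eq_zero_or_isHomogeneous d 1 (C (m : ℂ)⁻¹ * q)
    · exact Or.inl (by rw [h0, mul_zero])
    · refine Or.inr ⟨d - 1, by omega, ?_⟩
      rw [← map_natCast (C : ℂ →+* MvPolynomial (Fin (n + 1)) ℂ)]
      exact hhom.C_mul _
  · rw [mul_assoc, ← mul_add, ← hrel k]
end

section
/- Let n ≥ 1 and let f ∈ ℂ[z₀, …, zₙ] be a homogeneous polynomial of degree m ≥ 2 such that the only common zero in ℂ^{n+1} of the partial derivatives ∂f/∂z₀, …, ∂f/∂zₙ is the origin. Let d ≥ 0 and let g₀, …, gₙ ∈ ℂ[z₀, …, zₙ] be homogeneous of degree d such that f divides Σ_{i=0}^{n} gᵢ ∂f/∂zᵢ. If there is no polynomial q ∈ ℂ[z₀, …, zₙ] with g_k = q·z_k for every k, then m ≤ d + 1. -/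
open MvPolynomial

universe u

section LocalAlgebra

open IsLocalRing Module RingTheory.Sequence CategoryTheory Abelian Pointwise

variable {R : Type u} [CommRing R] [IsNoetherianRing R] [IsLocalRing R]
  {M : Type u} [AddCommGroup M] [Module R M] [Module.Finite R M]

theorem IsAssociatedPrime.exists_quotSMulTop {P : Ideal R} (hP : IsAssociatedPrime P M) {x : R}
    (hx : x ∈ maximalIdeal R) (reg : IsSMulRegular M x) :
    ∃ Q : Ideal R, IsAssociatedPrime Q (QuotSMulTop x M) ∧ P ≤ Q ∧ x ∈ Q := by
  obtain ⟨hPp, a, ha⟩ := isAssociatedPrime_iff.mp hP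
  let N : Submodule R M := Submodule.torsionBySet R M P
  have haN : a ∈ N := by
    rw [Submodule.mem_torsionBySet_iff]
    rintro ⟨p, hp⟩
    have hp' : p ∈ P := hp
    rw [ha] at hp'
    simpa [Submodule.mem_colon_singleton] using hp'
  have hne : N ≠ ⊥ := by
    intro h
    rw [h, Submodule.mem_bot] at haN
    refine hPp.ne_top ?_
    rw [ha, haN]
    simp
  have hnle : ¬ N ≤ x • (⊤ : Submodule R M) := by
    intro hle
    refine hne (Submodule.eq_bot_of_le_smul_of_le_jacobson_bot (Ideal.span {x}) N
      (IsNoetherian.noetherian N) ?_ ?_)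
    · intro y hy
      obtain ⟨z, -, rfl⟩ := hle hy
      rw [Submodule.ideal_span_singleton_smul]
      refine Submodule.smul_mem_pointwise_smul _ _ _ ?_
      rw [Submodule.mem_torsionBySet_iff] at hy ⊢
      intro p
      refine reg ?_
      have := hy p
      simp only [DistribSMul.toLinearMap_apply, smul_zero] at this ⊢
      rwa [smul_comm] at this
    · rw [Ideal.span_singleton_le_iff_mem]
      exact maximalIdeal_le_jacobson _ hx
  obtain ⟨y, hyN, hy⟩ := SetLike.not_le_iff_exists.mp hnle
  obtain ⟨Q, hQ, hle⟩ := exists_le_isAssociatedPrime_of_isNoetherianRing R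
    (Submodule.Quotient.mk y : QuotSMulTop x M) (by rwa [Ne, Submodule.Quotient.mk_eq_zero])
  refine ⟨Q, hQ, fun p hp => hle ?_, hle ?_⟩
  · rw [Submodule.mem_colon_singleton, Submodule.mem_bot, ← Submodule.Quotient.mk_smul,
      (Submodule.mem_torsionBySet_iff (R := R) _ _).mp hyN ⟨p, hp⟩, Submodule.Quotient.mk_zero]
  · rw [Submodule.mem_colon_singleton, Submodule.mem_bot, ← Submodule.Quotient.mk_smul,
      Submodule.Quotient.mk_eq_zero]
    exact Submodule.smul_mem_pointwise_smul _ _ _ trivial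

/-- The depth of a module is at most the dimension of each of its associated primes. -/
theorem RingTheory.Sequence.IsWeaklyRegular.length_le_supportDim_quotient {rs : List R}
    (mem : ∀ r ∈ rs, r ∈ maximalIdeal R) (reg : IsWeaklyRegular M rs) {P : Ideal R}
    (hP : IsAssociatedPrime P M) : (rs.length : WithBot ℕ∞) ≤ supportDim R (R ⧸ P) := by
  induction rs generalizing M P with
  | nil =>
    have := Ideal.Quotient.nontrivial_iff.mpr hP.isPrime.ne_top
    have h := supportDim_ne_bot_of_nontrivial R (R ⧸ P)
    rw [← WithBot.coe_unbot _ h]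
    exact WithBot.coe_le_coe.mpr zero_le
  | cons x rs ih =>
    simp only [List.mem_cons, forall_eq_or_imp] at mem
    rw [isWeaklyRegular_cons_iff] at reg
    obtain ⟨Q, hQ, hPQ, hxQ⟩ := hP.exists_quotSMulTop mem.1 reg.1
    have hxP : x ∉ P := fun h => by
      have := Set.ext_iff.mp (biUnion_associatedPrimes_eq_compl_regular R M) x
      exact this.mp (Set.mem_biUnion hP h) reg.1
    have hmin : ∀ p ∈ (annihilator R (R ⧸ P)).minimalPrimes, x ∉ p := by
      have := hP.isPrime
      rw [Ideal.annihilator_quotient, Ideal.minimalPrimes_eq_subsingleton_self]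
      simpa using hxP
    have hQx : supportDim R (R ⧸ Q) ≤ supportDim R (QuotSMulTop x (R ⧸ P)) := by
      have hsub : support R (R ⧸ Q) ⊆ support R (QuotSMulTop x (R ⧸ P)) := by
        intro q hq
        rw [support_eq_zeroLocus, Ideal.annihilator_quotient] at hq
        rw [support_quotSMulTop, support_eq_zeroLocus, Ideal.annihilator_quotient]
        exact ⟨fun a ha => hq (hPQ ha), by simpa using hq hxQ⟩
      exact Order.krullDim_le_of_strictMono (fun a ↦ ⟨a.1, hsub a.2⟩) (fun {_ _} lt ↦ lt)
    calc ((x :: rs).length : WithBot ℕ∞) = rs.length + 1 := by simp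
      _ ≤ supportDim R (QuotSMulTop x (R ⧸ P)) + 1 := by
        gcongr
        exact (ih mem.2 reg.2 hQ).trans hQx
      _ ≤ _ := supportDim_quotSMulTop_succ_le_of_notMem_minimalPrimes hmin

theorem Module.supportDim_le_length_of_forall_mem_support {fs : List R}
    (mem : ∀ r ∈ fs, r ∈ maximalIdeal R)
    (h : ∀ p ∈ support R M, (∀ r ∈ fs, r ∈ p.asIdeal) → p = closedPoint R) :
    supportDim R M ≤ fs.length := by
  induction fs generalizing M with
  | nil =>
    have : Subsingleton (support R M) := ⟨fun a b => Subtype.ext <| by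
      rw [h a a.2 (by simp), h b b.2 (by simp)]⟩
    simpa [supportDim] using Order.krullDim_nonpos_of_subsingleton (α := support R M)
  | cons x fs ih =>
    simp only [List.mem_cons, forall_eq_or_imp] at mem
    calc supportDim R M ≤ supportDim R (QuotSMulTop x M) + 1 :=
          supportDim_le_supportDim_quotSMulTop_succ mem.1
      _ ≤ fs.length + 1 := by
        gcongr
        refine ih mem.2 fun p hp hfs => h p ?_ ?_
        · rw [support_quotSMulTop] at hp
          exact hp.1
        · rw [support_quotSMulTop] at hp
          simpa using ⟨by simpa using hp.2, hfs⟩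
      _ = _ := by simp

/-- Depth drops by at most one modulo a regular element. -/
theorem exists_isRegular_quotSMulTop [Nontrivial M] {x : R} (hx : x ∈ maximalIdeal R)
    (reg : IsSMulRegular M x) {r : ℕ}
    (h : ∃ rs : List R, rs.length = r + 1 ∧ (∀ a ∈ rs, a ∈ maximalIdeal R) ∧ IsRegular M rs) :
    ∃ rs : List R, rs.length = r ∧ (∀ a ∈ rs, a ∈ maximalIdeal R) ∧
      IsRegular (QuotSMulTop x M) rs := by
  have := nontrivial_quotSMulTop_of_mem_maximalIdeal M hx
  have lt_top (L : Type u) [AddCommGroup L] [Module R L] [Module.Finite R L] [Nontrivial L] :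
      maximalIdeal R • (⊤ : Submodule R L) < ⊤ :=
    (Submodule.top_ne_ideal_smul_of_le_jacobson_annihilator
      (maximalIdeal_le_jacobson _)).symm.lt_top
  have hext := ((ModuleCat.exists_isRegular_tfae (maximalIdeal R) (r + 1) (ModuleCat.of R M)
    (lt_top M)).out 1 3).mpr h
  refine ((ModuleCat.exists_isRegular_tfae (maximalIdeal R) r
    (ModuleCat.of R (QuotSMulTop x M)) (lt_top _)).out 1 3).mp fun i hi => ?_
  have hM : (ModuleCat.smulShortComplex (ModuleCat.of R M) x).ShortExact :=
    IsSMulRegular.smulShortComplex_shortExact reg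
  have zero1 := AddCommGrpCat.isZero_of_iff_subsingleton.mpr (hext i (by omega))
  have zero2 := AddCommGrpCat.isZero_of_iff_subsingleton.mpr (hext (i + 1) (by omega))
  exact AddCommGrpCat.subsingleton_of_isZero <| ShortComplex.Exact.isZero_of_both_zeros
    ((Ext.covariant_sequence_exact₃' _ hM) i (i + 1) rfl)
    (zero1.eq_zero_of_src _) (zero2.eq_zero_of_tgt _)

/-- If a module has depth at least `r`, then any `r` elements cutting its support down to the
closed point form a weakly regular sequence. -/
theorem isWeaklyRegular_of_forall_mem_support [Nontrivial M] {fs : List R}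
    (mem : ∀ a ∈ fs, a ∈ maximalIdeal R)
    (depth : ∃ rs : List R, rs.length = fs.length ∧ (∀ a ∈ rs, a ∈ maximalIdeal R) ∧
      IsRegular M rs)
    (h : ∀ p ∈ support R M, (∀ a ∈ fs, a ∈ p.asIdeal) → p = closedPoint R) :
    IsWeaklyRegular M fs := by
  induction fs generalizing M with
  | nil => simp
  | cons x fs ih =>
    simp only [List.mem_cons, forall_eq_or_imp] at mem
    have hx : IsSMulRegular M x := by
      by_contra hx
      have := Set.ext_iff.mp (biUnion_associatedPrimes_eq_compl_regular R M) x
      obtain ⟨P, hP, hxP⟩ := Set.mem_iUnion₂.mp (this.mpr hx)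
      have hP : IsAssociatedPrime P M := hP
      obtain ⟨rs, hlen, hmem, hreg⟩ := depth
      have h1 := hreg.toIsWeaklyRegular.length_le_supportDim_quotient hmem hP
      have h2 : supportDim R (R ⧸ P) ≤ fs.length := by
        refine supportDim_le_length_of_forall_mem_support mem.2 fun p hp hfs => h p ?_ ?_
        · rw [support_eq_zeroLocus, Ideal.annihilator_quotient] at hp
          rw [mem_support_iff_of_finite]
          obtain ⟨-, a, ha⟩ := isAssociatedPrime_iff.mp hP
          refine le_trans (fun b hb => ?_) hp
          rw [ha, Submodule.mem_colon_singleton]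
          exact mem_annihilator.mp hb a
        · rw [support_eq_zeroLocus, Ideal.annihilator_quotient] at hp
          simpa using ⟨hp hxP, hfs⟩
      have h3 := h1.trans h2
      rw [hlen] at h3
      norm_cast at h3
      simp at h3
    have := nontrivial_quotSMulTop_of_mem_maximalIdeal M mem.1
    refine .cons hx (ih mem.2 (exists_isRegular_quotSMulTop mem.1 hx depth) fun p hp hfs => ?_)
    rw [support_quotSMulTop] at hp
    exact h p hp.1 (by simpa using ⟨by simpa using hp.2, hfs⟩)

end LocalAlgebra

section HomogeneousSystem

open IsLocalRing Module RingTheory.Sequence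

variable {k : Type u} [Field k]

theorem MvPolynomial.isWeaklyRegular_ofFn_X (n : ℕ) :
    IsWeaklyRegular (MvPolynomial (Fin n) k) (List.ofFn (X : Fin n → MvPolynomial (Fin n) k)) := by
  refine ⟨fun i hi => ?_⟩
  have hin : i < n := by simpa using hi
  have hspan : Ideal.ofList ((List.ofFn (X : Fin n → MvPolynomial (Fin n) k)).take i) =
      Ideal.span (X '' {j : Fin n | (j : ℕ) < i}) := by
    refine congrArg Ideal.span (Set.ext fun p => ?_)
    simp only [Set.mem_ofPred_eq, List.mem_take_iff_getElem, List.getElem_ofFn, List.length_ofFn,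
      Set.mem_image]
    constructor
    · rintro ⟨j, hj, rfl⟩
      exact ⟨⟨j, by omega⟩, by simp; omega, rfl⟩
    · rintro ⟨j, hj, rfl⟩
      exact ⟨j, by omega, rfl⟩
  rw [isSMulRegular_quotient_iff_mem_of_smul_mem]
  intro p hp
  rw [smul_eq_mul, Ideal.mul_top, hspan, mem_ideal_span_X_image] at hp ⊢
  intro m hm
  rw [List.getElem_ofFn, smul_eq_mul] at hp
  obtain ⟨j, hj, hne⟩ := hp (Finsupp.single ⟨i, hin⟩ 1 + m) (by
    rw [mem_support_iff, coeff_X_mul]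
    exact mem_support_iff.mp hm)
  refine ⟨j, hj, fun h0 => hne ?_⟩
  have hji : (⟨i, hin⟩ : Fin n) ≠ j := fun h => by
    simp [← h] at hj
  simp [h0, hji]

theorem MvPolynomial.mem_idealOfVars_iff {σ A : Type*} [CommRing A] (p : MvPolynomial σ A) :
    p ∈ idealOfVars σ A ↔ constantCoeff p = 0 := by
  have h := mem_pow_idealOfVars_iff' (σ := σ) (R := A) 1 p
  rw [pow_one] at h
  rw [h]
  simp [Finsupp.degree_eq_zero_iff, constantCoeff_eq]

instance MvPolynomial.isMaximal_idealOfVars {σ : Type*} : (idealOfVars σ k).IsMaximal := by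
  have h : idealOfVars σ k = RingHom.ker (constantCoeff : MvPolynomial σ k →+* k) := by
    ext p
    rw [mem_idealOfVars_iff, RingHom.mem_ker]
  rw [h]
  exact RingHom.ker_isMaximal_of_surjective _ fun a => ⟨C a, constantCoeff_C _ a⟩

/-- Homogeneous forms of degree `e` whose only common zero is the origin, as many as there are
variables, have no nonzero syzygy of degree less than `e`. -/
theorem MvPolynomial.eq_zero_of_sum_mul_eq_zero [IsAlgClosed k] {n e : ℕ} (he : e ≠ 0)
    {F : Fin (n + 1) → MvPolynomial (Fin (n + 1)) k} (hF : ∀ i, (F i).IsHomogeneous e)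
    (hzero : ∀ z : Fin (n + 1) → k, (∀ i, eval z (F i) = 0) → z = 0)
    {G : Fin (n + 1) → MvPolynomial (Fin (n + 1)) k} (hG : ∀ i, (G i).totalDegree < e)
    (hsum : ∑ i, G i * F i = 0) (j : Fin (n + 1)) : G j = 0 := by
  let S := MvPolynomial (Fin (n + 1)) k
  let 𝔪 : Ideal S := idealOfVars (Fin (n + 1)) k
  let R := Localization.AtPrime 𝔪
  have hFpow (i) : F i ∈ 𝔪 ^ e := by
    rw [mem_pow_idealOfVars_iff']
    intro x hx
    by_contra hne
    have : Finsupp.weight (fun _ => 1) x = e := hF i hne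
    rw [Finsupp.degree_eq_weight_one] at hx
    omega
  have hFm (i) : F i ∈ 𝔪 := Ideal.pow_le_self he (hFpow i)
  let others : List S := List.ofFn fun i : Fin n => F (j.succAbove i)
  have hothers : ∀ a ∈ others, ∃ i, a = F i := by
    intro a ha
    obtain ⟨i, rfl⟩ := List.mem_ofFn.mp ha
    exact ⟨_, rfl⟩
  have hmax {a : S} (ha : a ∈ 𝔪) : algebraMap S R a ∈ maximalIdeal R :=
    (IsLocalization.AtPrime.to_map_mem_maximal_iff R 𝔪 a).mpr ha
  have hreg : IsWeaklyRegular R (others.map (algebraMap S R) ++ [algebraMap S R (F j)]) := by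
    refine isWeaklyRegular_of_forall_mem_support ?_ ?_ ?_
    · intro a ha
      rw [List.mem_append, List.mem_map, List.mem_singleton] at ha
      obtain ⟨b, hb, rfl⟩ | rfl := ha
      · obtain ⟨i, rfl⟩ := hothers b hb
        exact hmax (hFm i)
      · exact hmax (hFm j)
    · refine ⟨(List.ofFn (X : Fin (n + 1) → S)).map (algebraMap S R), by simp [others], ?_, ?_⟩
      · intro a ha
        obtain ⟨b, hb, rfl⟩ := List.mem_map.mp ha
        obtain ⟨i, rfl⟩ := List.mem_ofFn.mp hb
        exact hmax (Ideal.subset_span ⟨i, rfl⟩)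
      · refine (isWeaklyRegular_ofFn_X (n + 1)).isRegular_of_isLocalization_of_mem R 𝔪 ?_
        intro b hb
        obtain ⟨i, rfl⟩ := List.mem_ofFn.mp hb
        exact Ideal.subset_span ⟨i, rfl⟩
    · intro p _ hp
      have hFp (i) : F i ∈ p.asIdeal.comap (algebraMap S R) := by
        refine hp _ ?_
        obtain rfl | ⟨l, rfl⟩ := j.eq_self_or_eq_succAbove i
        · simp
        · simp only [List.mem_append, List.mem_map]
          exact Or.inl ⟨_, List.mem_ofFn.mpr ⟨l, rfl⟩, rfl⟩
      have hle : 𝔪 ≤ p.asIdeal.comap (algebraMap S R) := by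
        intro a ha
        have hrad : a ∈ (Ideal.span (Set.range F)).radical := by
          rw [← vanishingIdeal_zeroLocus_eq_radical (K := k)]
          intro z hz
          have hz0 : z = 0 := hzero z fun i => by
            simpa [aeval_eq_eval] using hz (F i) (Ideal.subset_span ⟨i, rfl⟩)
          rw [hz0]
          simpa [aeval_zero] using (mem_idealOfVars_iff a).mp ha
        refine Ideal.IsPrime.radical_le_iff inferInstance |>.mpr ?_ hrad
        rw [Ideal.span_le]
        rintro _ ⟨i, rfl⟩
        exact hFp i
      refine PrimeSpectrum.ext ((IsLocalRing.eq_maximalIdeal ?_ : p.asIdeal = maximalIdeal R))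
      have hle' : maximalIdeal R ≤ p.asIdeal := by
        rw [← Localization.AtPrime.map_eq_maximalIdeal, Ideal.map_le_iff_le_comap]
        exact hle
      rw [← (maximalIdeal.isMaximal R).eq_of_le p.isPrime.ne_top hle']
      infer_instance
  rw [isWeaklyRegular_append_iff, isWeaklyRegular_singleton_iff,
    isSMulRegular_quotient_iff_mem_of_smul_mem] at hreg
  have hmem : algebraMap S R (G j) ∈ (Ideal.ofList others).map (algebraMap S R) := by
    have := hreg.2 (algebraMap S R (G j))
    rw [smul_eq_mul, smul_eq_mul, Ideal.mul_top, ← Ideal.map_ofList, ← map_mul] at this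
    refine this (Ideal.mem_map_of_mem _ ?_)
    rw [Fin.sum_univ_succAbove _ j, mul_comm] at hsum
    rw [eq_neg_of_add_eq_zero_left hsum]
    refine neg_mem (sum_mem fun i _ => Ideal.mul_mem_left _ _ (Ideal.subset_span ?_))
    exact List.mem_ofFn.mpr ⟨i, rfl⟩
  obtain ⟨s, hs, hsG⟩ :=
    (IsLocalization.algebraMap_mem_map_algebraMap_iff 𝔪.primeCompl R _ _).mp hmem
  have hle : Ideal.ofList others ≤ 𝔪 ^ e := by
    refine Ideal.span_le.mpr fun a ha => ?_
    obtain ⟨i, rfl⟩ := hothers a ha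
    exact hFpow i
  have hradical : (𝔪 ^ e).radical = 𝔪 := by
    rw [Ideal.radical_pow _ he, (isMaximal_idealOfVars.isPrime : 𝔪.IsPrime).radical]
  have hprimary : (𝔪 ^ e).IsPrimary := by
    refine Ideal.isPrimary_of_isMaximal_radical ?_
    rw [hradical]
    exact isMaximal_idealOfVars
  have hGpow : G j ∈ 𝔪 ^ e := by
    refine ((Ideal.isPrimary_iff.mp hprimary).2 (mul_comm s (G j) ▸ hle hsG)).resolve_right ?_
    rw [hradical]
    exact hs
  ext m
  rw [coeff_zero]
  by_contra hm
  have h1 := (mem_pow_idealOfVars_iff _ _).mp hGpow m (mem_support_iff.mpr hm)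
  have h2 := le_totalDegree (mem_support_iff.mpr hm)
  have h3 := hG j
  rw [Finsupp.degree_eq_sum] at h1
  rw [Finsupp.sum_fintype _ _ (by simp)] at h2
  omega

end HomogeneousSystem

/-- Soares' bound `m ≤ d + 1` in Esteves' algebraic formulation: a degree-`d`
homogeneous vector field tangent to a smooth degree-`m` hypersurface, not a multiple of
the radial vector field, forces `m ≤ d + 1`. -/
theorem esteves_soares_bound (n : ℕ) (hn : 1 ≤ n) (m : ℕ) (hm : 2 ≤ m)
    (f : MvPolynomial (Fin (n + 1)) ℂ) (hf : f.IsHomogeneous m)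
    (hzero : ∀ z : Fin (n + 1) → ℂ, (∀ i, eval z (pderiv i f) = 0) → z = 0)
    (d : ℕ) (g : Fin (n + 1) → MvPolynomial (Fin (n + 1)) ℂ)
    (hg : ∀ i, (g i).IsHomogeneous d)
    (hinv : f ∣ ∑ i, g i * pderiv i f)
    (hrad : ¬ ∃ q : MvPolynomial (Fin (n + 1)) ℂ, ∀ k, g k = q * X k) :
    m ≤ d + 1 := by
  by_contra! hlt
  obtain ⟨h, hh⟩ := hinv
  have hm0 : (m : ℂ) ≠ 0 := by
    have : m ≠ 0 := by omega
    exact_mod_cast this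
  have hf0 : f ≠ 0 := by
    rintro rfl
    have h1 := hzero (fun _ => 1) (by simp)
    simpa using congrFun h1 0
  have hdeg : h = 0 ∨ h.totalDegree + 1 ≤ d := by
    refine or_iff_not_imp_left.mpr fun h0 => ?_
    have hhom : (f * h).IsHomogeneous (d + (m - 1)) := by
      rw [← hh]
      exact IsHomogeneous.sum _ _ _ fun i _ => (hg i).mul hf.pderiv
    have h1 := hhom.totalDegree (mul_ne_zero hf0 h0)
    rw [totalDegree_mul_of_isDomain hf0 h0, hf.totalDegree hf0] at h1
    omega
  refine hrad ⟨C ((m : ℂ)⁻¹) * h, fun i => sub_eq_zero.mp ?_⟩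
  refine eq_zero_of_sum_mul_eq_zero (e := m - 1) (F := fun i => pderiv i f)
    (G := fun i => g i - C ((m : ℂ)⁻¹) * h * X i) (by omega) (fun _ => hf.pderiv) hzero ?_ ?_ i
  · intro i
    refine (totalDegree_sub _ _).trans_lt (max_lt ((hg i).totalDegree_le.trans_lt (by omega)) ?_)
    obtain rfl | hd := hdeg
    · simp; omega
    · refine (totalDegree_mul _ _).trans_lt ?_
      have h1 := totalDegree_mul (C ((m : ℂ)⁻¹)) h
      rw [totalDegree_C] at h1
      rw [totalDegree_X]
      omega
  · have heuler := hf.sum_X_mul_pderiv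
    simp only [sub_mul, Finset.sum_sub_distrib, hh, mul_assoc, ← Finset.mul_sum, heuler]
    rw [nsmul_eq_mul, ← map_natCast (C : ℂ →+* MvPolynomial (Fin (n + 1)) ℂ)]
    have hC : (C ((m : ℂ)⁻¹) * C (m : ℂ) : MvPolynomial (Fin (n + 1)) ℂ) = 1 := by
      rw [← C_mul, inv_mul_cancel₀ hm0, C_1]
    linear_combination (-(h * f)) * hC
end

section
/- Fix an integer m ≥ 2. In ℂ[z₀, z₁, z₂, z₃] let v₀ = −z₁^{m−1} − z₂^{m−1} − z₃^{m−1}, v₁ = z₀^{m−1} − z₂^{m−1} − z₃^{m−1}, v₂ = z₀^{m−1} + z₁^{m−1} − z₃^{m−1}, v₃ = z₀^{m−1} + z₁^{m−1} + z₂^{m−1}, and f = z₀^m + z₁^m + z₂^m + z₃^m. Then Σ_{i=0}^{3} vᵢ · ∂f/∂zᵢ = 0. In particular f divides the derivative of f along the vector field v = Σ vᵢ ∂/∂zᵢ, so the hypersurface {f = 0} is invariant by the degree-(m−1) foliation on ℙ³ induced by v. -/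
open MvPolynomial

/-- Soares' bound is sharp: the Fermat hypersurface of degree `m` in `ℙ³` is invariant by
a foliation of degree `m − 1`. -/
theorem fermat_invariant_example (m : ℕ) (hm : 2 ≤ m)
    (f : MvPolynomial (Fin 4) ℂ)
    (hf : f = X 0 ^ m + X 1 ^ m + X 2 ^ m + X 3 ^ m)
    (v : Fin 4 → MvPolynomial (Fin 4) ℂ)
    (hv0 : v 0 = -(X 1 ^ (m - 1)) - X 2 ^ (m - 1) - X 3 ^ (m - 1))
    (hv1 : v 1 = X 0 ^ (m - 1) - X 2 ^ (m - 1) - X 3 ^ (m - 1))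
    (hv2 : v 2 = X 0 ^ (m - 1) + X 1 ^ (m - 1) - X 3 ^ (m - 1))
    (hv3 : v 3 = X 0 ^ (m - 1) + X 1 ^ (m - 1) + X 2 ^ (m - 1)) :
    (∑ i, v i * pderiv i f = 0) ∧ f ∣ ∑ i, v i * pderiv i f := by
  have hpderiv (i : Fin 4) : pderiv i f = (m : MvPolynomial (Fin 4) ℂ) * X i ^ (m - 1) := by
    subst hf
    fin_cases i <;> simp [pderiv_X]
  have hsum : ∑ i, v i * pderiv i f = 0 := by
    simp only [Fin.sum_univ_four, hpderiv, hv0, hv1, hv2, hv3]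
    ring
  exact ⟨hsum, hsum ▸ dvd_zero f⟩
end

section
/- Fix an integer m ≥ 2. For z = (z₀, z₁, z₂, z₃) ∈ ℂ⁴ with z ≠ 0, suppose there exists λ ∈ ℂ such that −z₁^{m−1} − z₂^{m−1} − z₃^{m−1} = λz₀, z₀^{m−1} − z₂^{m−1} − z₃^{m−1} = λz₁, z₀^{m−1} + z₁^{m−1} − z₃^{m−1} = λz₂, and z₀^{m−1} + z₁^{m−1} + z₂^{m−1} = λz₃. Then z₀^m + z₁^m + z₂^m + z₃^m = 0. -/
/-- The singular set of the degree-`(m−1)` foliation on `ℙ³` induced by `v` is contained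
in the invariant Fermat hypersurface of degree `m`. -/
theorem fermat_contains_singularities (m : ℕ) (hm : 2 ≤ m) (z₀ z₁ z₂ z₃ : ℂ)
    (hz : ¬(z₀ = 0 ∧ z₁ = 0 ∧ z₂ = 0 ∧ z₃ = 0)) (lam : ℂ)
    (h0 : -z₁ ^ (m - 1) - z₂ ^ (m - 1) - z₃ ^ (m - 1) = lam * z₀)
    (h1 : z₀ ^ (m - 1) - z₂ ^ (m - 1) - z₃ ^ (m - 1) = lam * z₁)
    (h2 : z₀ ^ (m - 1) + z₁ ^ (m - 1) - z₃ ^ (m - 1) = lam * z₂)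
    (h3 : z₀ ^ (m - 1) + z₁ ^ (m - 1) + z₂ ^ (m - 1) = lam * z₃) :
    z₀ ^ m + z₁ ^ m + z₂ ^ m + z₃ ^ m = 0 := by
  obtain ⟨n, rfl⟩ : ∃ n, m = n + 1 := ⟨m - 1, by omega⟩
  simp only [Nat.add_sub_cancel] at h0 h1 h2 h3
  -- The matrix of `v` in the variables `zᵢ ^ n` is skew-symmetric.
  have hskew : lam * (z₀ ^ (n + 1) + z₁ ^ (n + 1) + z₂ ^ (n + 1) + z₃ ^ (n + 1)) = 0 := by
    linear_combination -z₀ ^ n * h0 - z₁ ^ n * h1 - z₂ ^ n * h2 - z₃ ^ n * h3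
  rcases mul_eq_zero.mp hskew with rfl | h
  · have e0 : z₀ ^ n = 0 := by linear_combination h3 - h2 + h1
    have e1 : z₁ ^ n = 0 := by linear_combination h1 - h0 - e0
    have e2 : z₂ ^ n = 0 := by linear_combination h2 - h1 - e1
    have e3 : z₃ ^ n = 0 := by linear_combination h3 - h2 - e2
    simp [pow_succ, e0, e1, e2, e3]
  · exact h
end

section
/- Let f₁, …, f_k ∈ ℂ[x₁, …, xₙ] be nonconstant irreducible polynomials that are pairwise coprime, and let λ₁, …, λ_k ∈ ℂ. If for every j ∈ {1, …, n} the product f₁⋯f_k divides Σ_{α=1}^{k} λ_α (∏_{β≠α} f_β) · ∂f_α/∂x_j, then λ_α = 0 for every α. -/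
open MvPolynomial Finset

namespace MvPolynomial

variable {σ R : Type*} [CommSemiring R]

theorem totalDegree_pderiv_lt {f : MvPolynomial σ R} (hf : 0 < f.totalDegree) (j : σ) :
    (pderiv j f).totalDegree < f.totalDegree := by
  rw [totalDegree, Finset.sup_lt_iff hf]
  intro m hm
  rw [mem_support_iff, coeff_pderiv] at hm
  have h := le_totalDegree (mem_support_iff.mpr (left_ne_zero_of_mul hm))
  rw [Finsupp.sum_add_index' (fun _ => rfl) (fun _ _ _ => rfl),
    Finsupp.sum_single_index rfl] at h
  omega

theorem exists_pderiv_ne_zero [NoZeroDivisors R] [CharZero R] {f : MvPolynomial σ R}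
    (hf : 0 < f.totalDegree) : ∃ j, pderiv j f ≠ 0 := by
  by_contra! h
  refine hf.ne' ((totalDegree_eq_zero_iff _ f).mpr fun m hm j => ?_)
  by_contra hmj
  have hle : Finsupp.single j 1 ≤ m := by
    rw [Finsupp.single_le_iff]
    omega
  have hc := congrArg (coeff (m - Finsupp.single j 1)) (h j)
  rw [coeff_pderiv, tsub_add_cancel_of_le hle, coeff_zero] at hc
  rcases mul_eq_zero.mp hc with hc | hc
  · exact mem_support_iff.mp hm hc
  · exact Nat.cast_add_one_ne_zero _ hc

theorem pderiv_eq_zero_of_dvd [NoZeroDivisors R] {f : MvPolynomial σ R} {j : σ}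
    (hf : 0 < f.totalDegree) (h : f ∣ pderiv j f) : pderiv j f = 0 := by
  by_contra hne
  exact (totalDegree_pderiv_lt hf j).not_ge (totalDegree_le_of_dvd_of_isDomain h hne)

end MvPolynomial

/-- Jouanolou's injectivity lemma, polynomial form: a ℂ-linear combination
`∑ λ_α df_α/f_α` of logarithmic differentials of pairwise coprime irreducible
polynomials has polynomial coefficients only when all `λ_α` vanish. -/
theorem jouanolou_injectivity (k n : ℕ)
    (f : Fin k → MvPolynomial (Fin n) ℂ)
    (hirr : ∀ α, Irreducible (f α))
    (hnc : ∀ α, 0 < (f α).totalDegree)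
    (hcop : ∀ α β, α ≠ β → IsRelPrime (f α) (f β))
    (lam : Fin k → ℂ)
    (hdvd : ∀ j : Fin n, (∏ α, f α) ∣
      ∑ α, C (lam α) * (∏ β ∈ Finset.univ.erase α, f β) * pderiv j (f α)) :
    ∀ α, lam α = 0 := by
  intro α
  by_contra hlam
  obtain ⟨j, hj⟩ := exists_pderiv_ne_zero (hnc α)
  have hprime : Prime (f α) := (hirr α).prime
  have hsum := (dvd_prod_of_mem f (mem_univ α)).trans (hdvd j)
  rw [← add_sum_erase _ _ (mem_univ α)] at hsum
  have hrest : f α ∣ ∑ γ ∈ univ.erase α,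
      C (lam γ) * (∏ β ∈ univ.erase γ, f β) * pderiv j (f γ) :=
    dvd_sum fun γ hγ => Dvd.dvd.mul_right (Dvd.dvd.mul_left
      (dvd_prod_of_mem f (mem_erase.mpr ⟨(ne_of_mem_erase hγ).symm, mem_univ α⟩)) _) _
  have hterm := (dvd_add_left hrest).mp hsum
  rcases hprime.dvd_or_dvd hterm with h | h
  · rcases hprime.dvd_or_dvd h with h | h
    · exact hprime.not_isUnit (isUnit_of_dvd_unit h ((isUnit_iff_ne_zero.mpr hlam).map C))
    · obtain ⟨β, hβ, h⟩ := hprime.exists_mem_finset_dvd h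
      exact hprime.not_isUnit (hcop α β (ne_of_mem_erase hβ).symm dvd_rfl h)
  · exact hj (pderiv_eq_zero_of_dvd (hnc α) h)
end
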